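/- arXiv:cond-mat/9610166 — 3 statements merged into one kernel-verified Lean document; each statement's English description precedes it below -/
import Mathlib

section
/- The velocity potential Θ(x,t) := −2ν ln b₀(x,t) is smooth on ℝ^d × (0,∞) and solves the potential Burgers equation ∂_t Θ + ½ ‖∇Θ‖² = ν Δ Θ there, where ∇ and Δ act in the x variable. -/
open MeasureTheory Real Filter Set

noncomputable section

/-- `Ed d` is the Euclidean space `ℝ^d`. -/
abbrev Ed (d : ℕ) : Type := EuclideanSpace ℝ (Fin d)

/-- `Φ(x,y,t) = ‖x−y‖²/(2t) + Θ₀(y)`. -/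
def Phi {d : ℕ} (Θ₀ : Ed d → ℝ) (x y : Ed d) (t : ℝ) : ℝ :=
  ‖x - y‖ ^ 2 / (2 * t) + Θ₀ y

/-- `b₀(x,t) = (4πνt)^{−d/2} ∫ exp(−Φ(x,y,t)/(2ν)) dy`. -/
def b0 {d : ℕ} (ν : ℝ) (Θ₀ : Ed d → ℝ) (x : Ed d) (t : ℝ) : ℝ :=
  (4 * π * ν * t) ^ (-(d : ℝ) / 2) * ∫ y, Real.exp (-Phi Θ₀ x y t / (2 * ν))

/-- `a₀(x,t) = (4πνt)^{−d/2} ∫ C₀(y) exp(−Φ(x,y,t)/(2ν)) dy`. -/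
def a0 {d : ℕ} (ν : ℝ) (Θ₀ C₀ : Ed d → ℝ) (x : Ed d) (t : ℝ) : ℝ :=
  (4 * π * ν * t) ^ (-(d : ℝ) / 2) * ∫ y, C₀ y * Real.exp (-Phi Θ₀ x y t / (2 * ν))

/-- `f(x)/‖x‖² → 0` as `‖x‖ → ∞`. -/
def SubQuadratic {d : ℕ} (f : Ed d → ℝ) : Prop :=
  Tendsto (fun x => f x / ‖x‖ ^ 2) (cocompact (Ed d)) (nhds 0)

/-- Spatial Laplacian `Δf(x) = ∑ᵢ ∂²f/∂xᵢ²`. -/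
def lap {d : ℕ} (f : Ed d → ℝ) (x : Ed d) : ℝ :=
  ∑ i : Fin d, fderiv ℝ (fun y => fderiv ℝ f y (EuclideanSpace.single i 1)) x
    (EuclideanSpace.single i 1)

/-- The linear functional `(u,s) ↦ ⟪y,u⟫ - s‖y‖²`. -/
def ell {d : ℕ} (y : Ed d) : (Ed d × ℝ) →L[ℝ] ℝ :=
  (innerSL ℝ y).comp (ContinuousLinearMap.fst ℝ (Ed d) ℝ)
    - (‖y‖ ^ 2) • ContinuousLinearMap.snd ℝ (Ed d) ℝ

lemma ell_apply {d : ℕ} (y : Ed d) (p : Ed d × ℝ) :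
    ell y p = inner ℝ y p.1 - ‖y‖ ^ 2 * p.2 := by
  simp [ell]

lemma ell_cont {d : ℕ} : Continuous (fun y : Ed d => ell y) := by
  unfold ell
  have h1 : Continuous (fun y : Ed d => innerSL ℝ y) := (innerSL ℝ (E := Ed d)).continuous
  exact (h1.clm_comp continuous_const).sub ((continuous_norm.pow 2).smul continuous_const)

lemma ell_norm {d : ℕ} (y : Ed d) : ‖ell y‖ ≤ ‖y‖ + ‖y‖ ^ 2 := by
  refine ContinuousLinearMap.opNorm_le_bound _ (by positivity) fun p => ?_
  rw [ell_apply]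
  have h1 : |inner ℝ y p.1| ≤ ‖y‖ * ‖p.1‖ := abs_real_inner_le_norm _ _
  have h2 : ‖p.1‖ ≤ ‖p‖ := norm_fst_le p
  have h3 : ‖p.2‖ ≤ ‖p‖ := norm_snd_le p
  calc ‖inner ℝ y p.1 - ‖y‖ ^ 2 * p.2‖ ≤ ‖inner ℝ y p.1‖ + ‖‖y‖ ^ 2 * p.2‖ := norm_sub_le _ _
    _ ≤ ‖y‖ * ‖p‖ + ‖y‖ ^ 2 * ‖p‖ := by
      rw [norm_mul, norm_pow, norm_norm]
      gcongr
      exact h1.trans (by gcongr)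
    _ = _ := by ring

/-- Continuous functions growing slower than every Gaussian. -/
def Good {d : ℕ} {F : Type} [NormedAddCommGroup F] (g : Ed d → F) : Prop :=
  Continuous g ∧ ∀ ε : ℝ, 0 < ε → ∃ C : ℝ, ∀ y, ‖g y‖ ≤ C * Real.exp (ε * ‖y‖ ^ 2)

/-- derivative weight -/
def dW {d : ℕ} {F : Type} [NormedAddCommGroup F] [NormedSpace ℝ F] (g : Ed d → F) (y : Ed d) :
    (Ed d × ℝ) →L[ℝ] F := (ell y).smulRight (g y)

lemma poly_bound (ε : ℝ) (hε : 0 < ε) (r : ℝ) :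
    r + r ^ 2 ≤ (1 + 2 / ε) * Real.exp (ε * r ^ 2) := by
  have h1 : ε * r ^ 2 + 1 ≤ Real.exp (ε * r ^ 2) := Real.add_one_le_exp _
  have h2 : (1 + 2 / ε) * (ε * r ^ 2 + 1) ≤ (1 + 2 / ε) * Real.exp (ε * r ^ 2) := by gcongr
  have h3 : (1 + 2 / ε) * (ε * r ^ 2 + 1) = ε * r ^ 2 + 1 + 2 * r ^ 2 + 2 / ε := by
    field_simp
    ring
  have h4 : 0 < 2 / ε := by positivity
  nlinarith [sq_nonneg (r - 1), mul_nonneg hε.le (sq_nonneg r)]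

lemma Good.mul {d : ℕ} {F G : Type} [NormedAddCommGroup F] [NormedAddCommGroup G]
    {g : Ed d → F} (hg : Good g) {h : Ed d → G} (hc : Continuous h)
    (hb : ∀ y, ‖h y‖ ≤ (‖y‖ + ‖y‖ ^ 2) * ‖g y‖) : Good h := by
  refine ⟨hc, fun ε hε => ?_⟩
  obtain ⟨C, hC⟩ := hg.2 (ε / 2) (by positivity)
  refine ⟨(1 + 2 / (ε / 2)) * C, fun y => (hb y).trans ?_⟩
  have := poly_bound (ε / 2) (by positivity) ‖y‖
  calc (‖y‖ + ‖y‖ ^ 2) * ‖g y‖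
      ≤ ((1 + 2 / (ε / 2)) * Real.exp (ε / 2 * ‖y‖ ^ 2)) * (C * Real.exp (ε / 2 * ‖y‖ ^ 2)) := by
        gcongr
        exact hC y
    _ = (1 + 2 / (ε / 2)) * C * (Real.exp (ε / 2 * ‖y‖ ^ 2) * Real.exp (ε / 2 * ‖y‖ ^ 2)) := by
        ring
    _ = _ := by
        rw [← Real.exp_add]
        congr 2
        ring

lemma Good.dW {d : ℕ} {F : Type} [NormedAddCommGroup F] [NormedSpace ℝ F]
    {g : Ed d → F} (hg : Good g) : Good (dW g) := by
  refine hg.mul ?_ fun y => ?_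
  · unfold _root_.dW
    exact ((ContinuousLinearMap.smulRightL ℝ (Ed d × ℝ) F).continuous.comp ell_cont).clm_apply hg.1
  · unfold _root_.dW
    rw [ContinuousLinearMap.norm_smulRight_apply]
    gcongr
    exact ell_norm y

lemma gauss_int {d : ℕ} (b : ℝ) (hb : 0 < b) :
    Integrable (fun y : Ed d => Real.exp (-b * ‖y‖ ^ 2)) := by
  have h := (GaussianFourier.integrable_cexp_neg_mul_sq_norm_add (V := Ed d) (b := (b : ℂ))
    (by simpa using hb) 0 0).norm
  refine h.congr (ae_of_all _ fun y => ?_)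
  simp only [Complex.norm_exp]
  congr 1
  simp [← Complex.ofReal_pow]

lemma exp_bound {d : ℕ} {F : Type} [NormedAddCommGroup F] {g : Ed d → F} (hg : Good g)
    (s₀ R : ℝ) (hs : 0 < s₀) : ∃ C : ℝ, ∀ p : Ed d × ℝ, ‖p.1‖ ≤ R → s₀ / 2 ≤ p.2 →
      ∀ y, Real.exp (ell y p) * ‖g y‖ ≤ C * Real.exp (-(s₀ / 4) * ‖y‖ ^ 2) := by
  obtain ⟨C, hC⟩ := hg.2 (s₀ / 8) (by positivity)
  refine ⟨Real.exp (2 * R ^ 2 / s₀) * C, fun p hp hs' y => ?_⟩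
  have h0 : ell y p ≤ R * ‖y‖ - s₀ / 2 * ‖y‖ ^ 2 := by
    rw [ell_apply]
    have := real_inner_le_norm y p.1
    nlinarith [norm_nonneg y, mul_le_mul_of_nonneg_left hp (norm_nonneg y),
      mul_le_mul_of_nonneg_left hs' (sq_nonneg ‖y‖)]
  have h1 : R * ‖y‖ ≤ s₀ / 8 * ‖y‖ ^ 2 + 2 * R ^ 2 / s₀ := by
    have : s₀ / 8 * ‖y‖ ^ 2 + 2 * R ^ 2 / s₀ - R * ‖y‖ = (s₀ * ‖y‖ - 4 * R) ^ 2 / (8 * s₀) := by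
      field_simp
      ring
    have h2 : 0 ≤ (s₀ * ‖y‖ - 4 * R) ^ 2 / (8 * s₀) := by positivity
    linarith
  calc Real.exp (ell y p) * ‖g y‖
      ≤ Real.exp (2 * R ^ 2 / s₀ - (s₀ / 8 + s₀ / 4) * ‖y‖ ^ 2)
          * (C * Real.exp (s₀ / 8 * ‖y‖ ^ 2)) := by
        gcongr
        · nlinarith
        · exact hC y
    _ = C * (Real.exp (2 * R ^ 2 / s₀ - (s₀ / 8 + s₀ / 4) * ‖y‖ ^ 2)
          * Real.exp (s₀ / 8 * ‖y‖ ^ 2)) := by ring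
    _ = C * (Real.exp (2 * R ^ 2 / s₀) * Real.exp (-(s₀ / 4) * ‖y‖ ^ 2)) := by
        rw [← Real.exp_add, ← Real.exp_add]
        congr 2
        ring
    _ = _ := by ring

/-- Laplace-type transform. -/
def JJ {d : ℕ} {F : Type} [NormedAddCommGroup F] [NormedSpace ℝ F] (g : Ed d → F)
    (p : Ed d × ℝ) : F := ∫ y, Real.exp (ell y p) • g y

lemma JJ_cont {d : ℕ} {F : Type} [NormedAddCommGroup F] [NormedSpace ℝ F] {g : Ed d → F}
    (hg : Good g) (p : Ed d × ℝ) : Continuous fun y => Real.exp (ell y p) • g y :=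
  (Real.continuous_exp.comp (ell_cont.clm_apply continuous_const)).smul hg.1

lemma JJ_int {d : ℕ} {F : Type} [NormedAddCommGroup F] [NormedSpace ℝ F] {g : Ed d → F}
    (hg : Good g) (p : Ed d × ℝ) (hp : 0 < p.2) :
    Integrable fun y => Real.exp (ell y p) • g y := by
  obtain ⟨C, hC⟩ := exp_bound hg p.2 ‖p.1‖ hp
  refine ((gauss_int (d := d) (p.2 / 4) (by positivity)).const_mul C).mono'
    (JJ_cont hg p).aestronglyMeasurable (ae_of_all _ fun y => ?_)
  rw [norm_smul, Real.norm_of_nonneg (Real.exp_pos _).le]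
  exact hC p le_rfl (by linarith) y

lemma JJ_deriv {d : ℕ} {F : Type} [NormedAddCommGroup F] [NormedSpace ℝ F] {g : Ed d → F}
    (hg : Good g) (p : Ed d × ℝ) (hp : 0 < p.2) :
    HasFDerivAt (JJ g) (JJ (dW g) p) p := by
  obtain ⟨C, hC⟩ := exp_bound hg.dW p.2 (‖p.1‖ + p.2 / 2) hp
  refine hasFDerivAt_integral_of_dominated_of_fderiv_le (s := Metric.ball p (p.2 / 2))
    (F := fun p y => Real.exp (ell y p) • g y) (F' := fun p y => Real.exp (ell y p) • dW g y)
    (bound := fun y => C * Real.exp (-(p.2 / 4) * ‖y‖ ^ 2))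
    (Metric.ball_mem_nhds _ (by positivity))
    (Eventually.of_forall fun q => (JJ_cont hg q).aestronglyMeasurable) (JJ_int hg p hp)
    (JJ_cont hg.dW p).aestronglyMeasurable (ae_of_all _ fun y q hq => ?_)
    ((gauss_int (d := d) (p.2 / 4) (by positivity)).const_mul C)
    (ae_of_all _ fun y q hq => ?_)
  · rw [norm_smul, Real.norm_of_nonneg (Real.exp_pos _).le]
    rw [mem_ball_iff_norm] at hq
    have h1 : ‖q.1 - p.1‖ ≤ ‖q - p‖ := norm_fst_le (q - p)
    have h2 : |q.2 - p.2| ≤ ‖q - p‖ := norm_snd_le (q - p)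
    refine hC q ?_ ?_ y
    · have := norm_le_norm_add_norm_sub' q.1 p.1
      linarith
    · have := (abs_le.1 h2).1
      linarith
  · have h := ((ell y).hasFDerivAt (x := q)).exp.smul_const (g y)
    convert h using 1
    ext v <;> simp [dW, mul_smul]

lemma JJ_smooth_nat {d : ℕ} (n : ℕ) : ∀ {F : Type} [NormedAddCommGroup F] [NormedSpace ℝ F]
    {g : Ed d → F}, Good g → ∀ p : Ed d × ℝ, 0 < p.2 → ContDiffAt ℝ n (JJ g) p := by
  induction n with
  | zero =>
    intro F _ _ g hg p hp
    have ho : {q : Ed d × ℝ | 0 < q.2} ∈ nhds p :=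
      (isOpen_lt continuous_const continuous_snd).mem_nhds hp
    exact contDiffAt_zero.2 ⟨_, ho, fun q hq => (JJ_deriv hg q hq).continuousAt.continuousWithinAt⟩
  | succ n ih =>
    intro F _ _ g hg p hp
    have ho : {q : Ed d × ℝ | 0 < q.2} ∈ nhds p :=
      (isOpen_lt continuous_const continuous_snd).mem_nhds hp
    exact_mod_cast contDiffAt_succ_iff_hasFDerivAt.2
      ⟨JJ (dW g), ⟨_, ho, fun q hq => JJ_deriv hg q hq⟩, ih hg.dW p hp⟩

lemma JJ_smooth {d : ℕ} {F : Type} [NormedAddCommGroup F] [NormedSpace ℝ F]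
    {g : Ed d → F} (hg : Good g) (p : Ed d × ℝ) (hp : 0 < p.2) :
    ContDiffAt ℝ (⊤ : ℕ∞) (JJ g) p :=
  contDiffAt_infty.2 fun n => JJ_smooth_nat n hg p hp

lemma JJ_deriv_apply {d : ℕ} {g : Ed d → ℝ} (hg : Good g) (p : Ed d × ℝ) (hp : 0 < p.2)
    (v : Ed d × ℝ) : JJ (dW g) p v = JJ (fun y => ell y v * g y) p := by
  unfold JJ
  rw [ContinuousLinearMap.integral_apply (JJ_int hg.dW p hp)]
  simp [dW]

lemma good_weight {d : ℕ} (ν : ℝ) (hν : 0 < ν) (Θ₀ : Ed d → ℝ) (hc : Continuous Θ₀)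
    (hd : SubQuadratic Θ₀) : Good (fun y => Real.exp (-Θ₀ y / (2 * ν))) := by
  have hcont : Continuous (fun y => Real.exp (-Θ₀ y / (2 * ν))) := by fun_prop
  refine ⟨hcont, fun ε hε => ?_⟩
  have h1 : ∀ᶠ y in cocompact (Ed d), -(2 * ν * ε) < Θ₀ y / ‖y‖ ^ 2 :=
    hd.eventually (lt_mem_nhds (by simp; positivity))
  obtain ⟨K, hK, hK'⟩ := mem_cocompact.1 h1
  obtain ⟨C, hC⟩ := (hK.insert 0).bddAbove_image hcont.continuousOn
  refine ⟨max C 1, fun y => ?_⟩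
  rw [Real.norm_of_nonneg (Real.exp_pos _).le]
  have he : 1 ≤ Real.exp (ε * ‖y‖ ^ 2) := Real.one_le_exp (by positivity)
  by_cases hy : y ∈ insert 0 K
  · have h2 : Real.exp (-Θ₀ y / (2 * ν)) ≤ C := hC (mem_image_of_mem _ hy)
    have h3 : Real.exp (-Θ₀ y / (2 * ν)) ≤ max C 1 := h2.trans (le_max_left _ _)
    have : (0 : ℝ) ≤ max C 1 := zero_le_one.trans (le_max_right _ _)
    nlinarith
  · rw [mem_insert_iff, not_or] at hy
    have h2 : -(2 * ν * ε) < Θ₀ y / ‖y‖ ^ 2 := hK' hy.2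
    have hn : 0 < ‖y‖ ^ 2 := by have := norm_pos_iff.2 hy.1; positivity
    rw [lt_div_iff₀ hn] at h2
    have h3 : Real.exp (-Θ₀ y / (2 * ν)) ≤ Real.exp (ε * ‖y‖ ^ 2) := by
      gcongr
      rw [div_le_iff₀ (by positivity)]
      nlinarith
    have h4 := le_max_right C 1
    nlinarith

lemma JJ_pos {d : ℕ} (ν : ℝ) (Θ₀ : Ed d → ℝ)
    (hg : Good (fun y => Real.exp (-Θ₀ y / (2 * ν)))) (p : Ed d × ℝ) (hp : 0 < p.2) :
    0 < JJ (fun y => Real.exp (-Θ₀ y / (2 * ν))) p := by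
  have h := JJ_int hg p hp
  unfold JJ
  simp only [smul_eq_mul, ← Real.exp_add] at h ⊢
  exact integral_exp_pos h

lemma b0_eq {d : ℕ} (ν : ℝ) (hν : 0 < ν) (Θ₀ : Ed d → ℝ) (x : Ed d) (t : ℝ) (ht : 0 < t) :
    b0 ν Θ₀ x t = (4 * π * ν * t) ^ (-(d : ℝ) / 2) * (Real.exp (-((4 * ν * t)⁻¹ * ‖x‖ ^ 2)) *
      JJ (fun y => Real.exp (-Θ₀ y / (2 * ν))) ((2 * (4 * ν * t)⁻¹) • x, (4 * ν * t)⁻¹)) := by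
  unfold b0 JJ
  congr 1
  rw [← integral_const_mul]
  refine integral_congr_ae (ae_of_all _ fun y => ?_)
  simp only [smul_eq_mul, ← Real.exp_add]
  congr 1
  rw [ell_apply, Phi, norm_sub_sq_real, inner_smul_right, real_inner_comm x y]
  field_simp
  ring

lemma theta_eq {d : ℕ} (ν : ℝ) (hν : 0 < ν) (Θ₀ : Ed d → ℝ)
    (hg : Good (fun y => Real.exp (-Θ₀ y / (2 * ν)))) (x : Ed d) (t : ℝ) (ht : 0 < t) :
    -2 * ν * Real.log (b0 ν Θ₀ x t) = -2 * ν * (-(d : ℝ) / 2 * Real.log (4 * π * ν * t)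
      - (4 * ν * t)⁻¹ * ‖x‖ ^ 2 + Real.log (JJ (fun y => Real.exp (-Θ₀ y / (2 * ν)))
        ((2 * (4 * ν * t)⁻¹) • x, (4 * ν * t)⁻¹))) := by
  have hJ := JJ_pos ν Θ₀ hg ((2 * (4 * ν * t)⁻¹) • x, (4 * ν * t)⁻¹)
    (by change 0 < (4 * ν * t)⁻¹; positivity)
  have h4 : 0 < 4 * π * ν * t := by positivity
  rw [b0_eq ν hν Θ₀ x t ht, Real.log_mul (by positivity) (by positivity),
    Real.log_mul (by positivity) (by positivity), Real.log_exp, Real.log_rpow h4]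
  ring

lemma good_inner {d : ℕ} {g : Ed d → ℝ} (hg : Good g) (i : Fin d) :
    Good (fun z => inner ℝ z (EuclideanSpace.single i (1 : ℝ)) * g z) := by
  refine hg.mul ?_ fun y => ?_
  · exact (continuous_id.inner continuous_const).mul hg.1
  · rw [norm_mul]
    gcongr
    have := abs_real_inner_le_norm y (EuclideanSpace.single i (1 : ℝ))
    simp only [PiLp.norm_single, norm_one, mul_one] at this
    rw [Real.norm_eq_abs]
    nlinarith [sq_nonneg ‖y‖]

lemma space_deriv {d : ℕ} {g : Ed d → ℝ} (hg : Good g) (s : ℝ) (hs : 0 < s) (x : Ed d) :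
    ∃ L : Ed d →L[ℝ] ℝ, HasFDerivAt (fun y : Ed d => JJ g ((2 * s) • y, s)) L x ∧
      ∀ v, L v = 2 * s * JJ (fun z => inner ℝ z v * g z) ((2 * s) • x, s) := by
  have h1 := JJ_deriv hg ((2 * s) • x, s) hs
  have h2 : HasFDerivAt (fun y : Ed d => ((2 * s) • y, s))
      (((2 * s) • ContinuousLinearMap.id ℝ (Ed d)).prod 0) x :=
    ((hasFDerivAt_id x).const_smul (2 * s)).prodMk (hasFDerivAt_const _ _)
  refine ⟨_, HasFDerivAt.comp (g := JJ g) x h1 h2, fun v => ?_⟩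
  have h3 : (((2 * s) • ContinuousLinearMap.id ℝ (Ed d)).prod (0 : Ed d →L[ℝ] ℝ)) v
      = (2 * s) • ((v, 0) : Ed d × ℝ) := by
    ext <;> simp
  rw [ContinuousLinearMap.comp_apply, h3, map_smul, JJ_deriv_apply hg _ hs]
  simp [ell_apply]

lemma inner_eq_sum_coord {d : ℕ} (z x : Ed d) :
    inner ℝ z x = ∑ i, x i * inner ℝ z (EuclideanSpace.single i (1 : ℝ)) := by
  simp [PiLp.inner_apply]

lemma norm_sq_eq_sum_coord {d : ℕ} (z : Ed d) :
    ‖z‖ ^ 2 = ∑ i, (inner ℝ z (EuclideanSpace.single i (1 : ℝ))) ^ 2 := by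
  simp [EuclideanSpace.real_norm_sq_eq, EuclideanSpace.inner_single_right]

lemma time_deriv {d : ℕ} {g : Ed d → ℝ} (hg : Good g) (ν : ℝ) (hν : 0 < ν) (x : Ed d) (t : ℝ)
    (ht : 0 < t) (s : ℝ) (hs : s = (4 * ν * t)⁻¹) :
    HasDerivAt (fun t : ℝ => JJ g ((2 * (4 * ν * t)⁻¹) • x, (4 * ν * t)⁻¹))
      (-(4 * ν * s ^ 2) * ∑ i, (2 * x i *
          JJ (fun z => inner ℝ z (EuclideanSpace.single i (1 : ℝ)) * g z) ((2 * s) • x, s)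
        - JJ (fun z => inner ℝ z (EuclideanSpace.single i (1 : ℝ)) *
          (inner ℝ z (EuclideanSpace.single i (1 : ℝ)) * g z)) ((2 * s) • x, s))) t := by
  have hs0 : 0 < s := by rw [hs]; positivity
  have hd : HasDerivAt (fun t : ℝ => (4 * ν * t)⁻¹) (-(4 * ν * s ^ 2)) t := by
    have h := ((hasDerivAt_id t).const_mul (4 * ν)).inv (by simp; constructor <;> positivity)
    convert! h using 1
    rw [hs]
    simp only [id]
    field_simp
  have hd2 := (hd.const_mul 2).smul_const x
  have h1 := JJ_deriv hg ((2 * s) • x, s) hs0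
  rw [hs] at h1
  have h3 := h1.comp_hasDerivAt t (hd2.prodMk hd)
  rw [← hs] at h3
  convert! h3 using 1
  have h4 : (((2 * -(4 * ν * s ^ 2)) • x, -(4 * ν * s ^ 2)) : Ed d × ℝ)
      = (-(4 * ν * s ^ 2)) • ((2 : ℝ) • x, (1 : ℝ)) := by
    ext <;> simp
    ring
  rw [h4, map_smul, JJ_deriv_apply hg _ hs0, smul_eq_mul]
  congr 1
  have hi := fun i => JJ_int (good_inner hg i) ((2 * s) • x, s) hs0
  have hii := fun i => JJ_int (good_inner (good_inner hg i) i) ((2 * s) • x, s) hs0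
  unfold JJ
  simp_rw [← integral_const_mul]
  have hsub := fun i => integral_sub ((hi i).const_mul (2 * x i)) (hii i)
  have hsum := integral_finsetSum Finset.univ
    fun i _ => ((hi i).const_mul (2 * x i)).sub (hii i)
  simp only [Pi.sub_apply] at hsum
  rw [Finset.sum_congr rfl fun i _ => (hsub i).symm, ← hsum]
  refine integral_congr_ae (ae_of_all _ fun z => ?_)
  simp only [smul_eq_mul]
  rw [ell_apply z ((2 : ℝ) • x, (1 : ℝ)), inner_smul_right, inner_eq_sum_coord z x, norm_sq_eq_sum_coord z,
    Finset.mul_sum, mul_one, ← Finset.sum_sub_distrib, Finset.sum_mul, Finset.mul_sum]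
  refine Finset.sum_congr rfl fun i _ => ?_
  ring

lemma grad_sq {d : ℕ} (f : Ed d → ℝ) (x : Ed d) :
    ‖gradient f x‖ ^ 2 = ∑ i, (fderiv ℝ f x (EuclideanSpace.single i (1 : ℝ))) ^ 2 := by
  rw [norm_sq_eq_sum_coord]
  refine Finset.sum_congr rfl fun i _ => ?_
  rw [← toDual_gradient, InnerProductSpace.toDual_apply_apply]

/-- The velocity potential `Θ(x,t) := −2ν ln b₀(x,t)` is smooth on `ℝ^d × (0,∞)` and
solves the potential Burgers equation `∂ₜΘ + ½‖∇Θ‖² = νΔΘ` there. -/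
theorem statement5 (d : ℕ) (hd : 1 ≤ d) (ν : ℝ) (hν : 0 < ν)
    (Θ₀ : Ed d → ℝ) (hΘ₀cont : Continuous Θ₀) (hΘ₀dec : SubQuadratic Θ₀) :
    ContDiffOn ℝ (⊤ : ℕ∞) (fun p : Ed d × ℝ => -2 * ν * Real.log (b0 ν Θ₀ p.1 p.2))
        (univ ×ˢ Ioi 0) ∧
      ∀ (x : Ed d) (t : ℝ), 0 < t →
        deriv (fun s => -2 * ν * Real.log (b0 ν Θ₀ x s)) t
            + (1 / 2) * ‖gradient (fun y => -2 * ν * Real.log (b0 ν Θ₀ y t)) x‖ ^ 2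
          = ν * lap (fun y => -2 * ν * Real.log (b0 ν Θ₀ y t)) x := by
  have hg := good_weight ν hν Θ₀ hΘ₀cont hΘ₀dec
  have hopen : IsOpen ((univ : Set (Ed d)) ×ˢ Ioi (0 : ℝ)) := isOpen_univ.prod isOpen_Ioi
  refine ⟨?_, fun x t ht => ?_⟩
  · have hE : ∀ p ∈ (univ : Set (Ed d)) ×ˢ Ioi (0 : ℝ),
        (fun p : Ed d × ℝ => -2 * ν * Real.log (b0 ν Θ₀ p.1 p.2)) p = _ :=
      fun p hp => theta_eq ν hν Θ₀ hg p.1 p.2 hp.2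
    refine ContDiffOn.congr ?_ hE
    intro p hp
    have hp2 : 0 < p.2 := hp.2
    refine ContDiffAt.contDiffWithinAt ?_
    have h4 : 4 * π * ν * p.2 ≠ 0 := by positivity
    have h4' : 4 * ν * p.2 ≠ 0 := by positivity
    have hs0 : 0 < (4 * ν * p.2)⁻¹ := by positivity
    have hinv : ContDiffAt ℝ (⊤ : ℕ∞) (fun p : Ed d × ℝ => (4 * ν * p.2)⁻¹) p :=
      (contDiffAt_const.mul contDiffAt_snd).inv h4'
    have hlog : ContDiffAt ℝ (⊤ : ℕ∞) (fun p : Ed d × ℝ => Real.log (4 * π * ν * p.2)) p :=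
      (contDiffAt_const.mul contDiffAt_snd).log h4
    have hn : ContDiffAt ℝ (⊤ : ℕ∞) (fun p : Ed d × ℝ => ‖p.1‖ ^ 2) p :=
      contDiffAt_fst.norm_sq ℝ
    have hJ := (JJ_smooth hg ((2 * (4 * ν * p.2)⁻¹) • p.1, (4 * ν * p.2)⁻¹) hs0).comp p
      (((contDiffAt_const.mul hinv).smul contDiffAt_fst).prodMk hinv)
    have hJl := hJ.log (JJ_pos ν Θ₀ hg _ hs0).ne'
    exact contDiffAt_const.mul (((contDiffAt_const.mul hlog).sub (hinv.mul hn)).add hJl)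
  · obtain ⟨s, hs⟩ : ∃ s, s = (4 * ν * t)⁻¹ := ⟨_, rfl⟩
    have hs0 : 0 < s := by rw [hs]; positivity
    have hJpos := fun y : Ed d => JJ_pos ν Θ₀ hg ((2 * s) • y, s) hs0
    -- time derivative
    have hT : HasDerivAt (fun s => -2 * ν * Real.log (b0 ν Θ₀ x s))
        (-2 * ν * (-(d : ℝ) / 2 * (1 / t) - -(4 * ν * s ^ 2) * ‖x‖ ^ 2 +
          (-(4 * ν * s ^ 2) * ∑ i, (2 * x i *
            JJ (fun z => inner ℝ z (EuclideanSpace.single i (1 : ℝ)) *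
              Real.exp (-Θ₀ z / (2 * ν))) ((2 * s) • x, s)
            - JJ (fun z => inner ℝ z (EuclideanSpace.single i (1 : ℝ)) *
              (inner ℝ z (EuclideanSpace.single i (1 : ℝ)) * Real.exp (-Θ₀ z / (2 * ν))))
                ((2 * s) • x, s))) /
            JJ (fun z => Real.exp (-Θ₀ z / (2 * ν))) ((2 * s) • x, s))) t := by
      have h1 := time_deriv hg ν hν x t ht s hs
      have h2 := h1.log (by rw [← hs]; exact (hJpos x).ne')
      have hd : HasDerivAt (fun t : ℝ => (4 * ν * t)⁻¹) (-(4 * ν * s ^ 2)) t := by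
        have h := ((hasDerivAt_id t).const_mul (4 * ν)).inv (by simp; constructor <;> positivity)
        convert! h using 1
        rw [hs]
        simp only [id]
        field_simp
      have hl : HasDerivAt (fun t : ℝ => Real.log (4 * π * ν * t)) (1 / t) t := by
        have h := ((hasDerivAt_id t).const_mul (4 * π * ν)).log
          (by simp only [id]; positivity)
        convert! h using 1
        simp only [id]
        field_simp
      have h3 := (((hl.const_mul (-(d : ℝ) / 2)).sub (hd.mul_const (‖x‖ ^ 2))).add h2).const_mul
        (-2 * ν)
      rw [← hs] at h3
      refine h3.congr_of_eventuallyEq ?_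
      filter_upwards [lt_mem_nhds ht] with r hr
      exact theta_eq ν hν Θ₀ hg x r hr
    -- space derivatives
    have hf : (fun y => -2 * ν * Real.log (b0 ν Θ₀ y t)) = _ :=
      funext fun y => theta_eq ν hν Θ₀ hg y t ht
    rw [← hs] at hf
    have hS : ∀ y v, fderiv ℝ (fun y => -2 * ν * Real.log (b0 ν Θ₀ y t)) y v
        = -2 * ν * (-(2 * s * inner ℝ y v) +
          2 * s * JJ (fun z => inner ℝ z v * Real.exp (-Θ₀ z / (2 * ν))) ((2 * s) • y, s) /
            JJ (fun z => Real.exp (-Θ₀ z / (2 * ν))) ((2 * s) • y, s)) := by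
      intro y v
      obtain ⟨L, hL, hLv⟩ := space_deriv hg s hs0 y
      have h1 := hL.log (hJpos y).ne'
      have h2 : HasFDerivAt (fun y : Ed d => ‖y‖ ^ 2) _ y := (hasFDerivAt_id y).norm_sq
      have h3 := (((hasFDerivAt_const (-(d : ℝ) / 2 * Real.log (4 * π * ν * t)) y).sub
        (h2.const_mul s)).add h1).const_mul (-2 * ν)
      rw [hf]
      refine (DFunLike.congr_fun (HasFDerivAt.fderiv h3) v).trans ?_
      simp [hLv]
      ring
    have hSS : ∀ i, fderiv ℝ (fun y => fderiv ℝ (fun y => -2 * ν * Real.log (b0 ν Θ₀ y t)) y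
          (EuclideanSpace.single i (1 : ℝ))) x (EuclideanSpace.single i (1 : ℝ))
        = -2 * ν * (-(2 * s) + 2 * s * (2 * s) *
          (JJ (fun z => inner ℝ z (EuclideanSpace.single i (1 : ℝ)) *
            (inner ℝ z (EuclideanSpace.single i (1 : ℝ)) * Real.exp (-Θ₀ z / (2 * ν))))
              ((2 * s) • x, s) * JJ (fun z => Real.exp (-Θ₀ z / (2 * ν))) ((2 * s) • x, s)
           - JJ (fun z => inner ℝ z (EuclideanSpace.single i (1 : ℝ)) *
              Real.exp (-Θ₀ z / (2 * ν))) ((2 * s) • x, s) ^ 2) /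
            JJ (fun z => Real.exp (-Θ₀ z / (2 * ν))) ((2 * s) • x, s) ^ 2) := by
      intro i
      simp_rw [hS, div_eq_mul_inv _ (JJ (fun z => Real.exp (-Θ₀ z / (2 * ν))) _)]
      obtain ⟨L, hL, hLv⟩ := space_deriv hg s hs0 x
      obtain ⟨M, hM, hMv⟩ := space_deriv (good_inner hg i) s hs0 x
      have hinn : HasFDerivAt (fun y : Ed d => inner ℝ y (EuclideanSpace.single i (1 : ℝ)))
          (innerSL ℝ (EuclideanSpace.single i (1 : ℝ))) x := by
        have := (innerSL ℝ (EuclideanSpace.single i (1 : ℝ) : Ed d)).hasFDerivAt (x := x)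
        refine this.congr_of_eventuallyEq (Eventually.of_forall fun y => ?_)
        rw [innerSL_apply_apply, real_inner_comm]
      have h3 := ((hinn.const_mul (2 * s)).neg.add
        ((hM.const_mul (2 * s)).mul ((hasDerivAt_inv (hJpos x).ne').comp_hasFDerivAt x hL))).const_mul (-2 * ν)
      refine (DFunLike.congr_fun (HasFDerivAt.fderiv h3) _).trans ?_
      have hJ0 := (hJpos x).ne'
      simp [hLv, hMv]
      field_simp
      ring
    rw [hT.deriv, grad_sq, lap]
    simp_rw [hSS, hS]
    have hJ0 := (hJpos x).ne'
    generalize JJ (fun z => Real.exp (-Θ₀ z / (2 * ν))) ((2 * s) • x, s) = J at hJ0 ⊢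
    have hd1 : (d : ℝ) = ∑ i : Fin d, (1 : ℝ) := by simp
    have hx : ‖x‖ ^ 2 = ∑ i, x i ^ 2 := EuclideanSpace.real_norm_sq_eq x
    have hxi : ∀ i, inner ℝ x (EuclideanSpace.single i (1 : ℝ)) = x i := by
      intro i
      simp [EuclideanSpace.inner_single_right]
    simp_rw [hxi]
    have hts : 1 / t = 4 * ν * s := by
      rw [hs]
      field_simp
    rw [hd1, hx, hts]
    have key : ∀ (A B : Fin d → ℝ),
        -2 * ν * (-(∑ i : Fin d, (1 : ℝ)) / 2 * (4 * ν * s) - -(4 * ν * s ^ 2) * ∑ i, x i ^ 2 +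
          (-(4 * ν * s ^ 2) * ∑ i, (2 * x i * A i - B i)) / J)
        + 1 / 2 * ∑ i, (-2 * ν * (-(2 * s * x i) + 2 * s * A i / J)) ^ 2
        = ν * ∑ i, -2 * ν * (-(2 * s) + 2 * s * (2 * s) * (B i * J - A i ^ 2) / J ^ 2) := by
      intro A B
      have e : -2 * ν * (-(∑ i : Fin d, (1 : ℝ)) / 2 * (4 * ν * s)
          - -(4 * ν * s ^ 2) * ∑ i, x i ^ 2 +
          (-(4 * ν * s ^ 2) * ∑ i, (2 * x i * A i - B i)) / J)
          = (4 * ν ^ 2 * s) * (∑ i : Fin d, (1 : ℝ)) + (-8 * ν ^ 2 * s ^ 2) * ∑ i, x i ^ 2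
            + (8 * ν ^ 2 * s ^ 2 / J) * ∑ i, (2 * x i * A i - B i) := by
        field_simp
        ring
      rw [e]
      simp only [Finset.mul_sum]
      rw [← Finset.sum_add_distrib, ← Finset.sum_add_distrib, ← Finset.sum_add_distrib]
      refine Finset.sum_congr rfl fun i _ => ?_
      field_simp
      ring
    exact key _ _
end
end

section
/- The velocity potential attains its initial condition: for every x ∈ ℝ^d, −2ν ln b₀(x,t) → Θ₀(x) as t → 0⁺. -/
open MeasureTheory Real Filter Set

noncomputable section

theorem aux_bound {d : ℕ} (f : Ed d → ℝ) (hc : Continuous f) (hs : SubQuadratic f) :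
    ∃ C : ℝ, ∀ y, -f y ≤ C + ‖y‖ ^ 2 / 8 := by
  have h1 : ∀ᶠ y in cocompact (Ed d), -(1/8 : ℝ) < f y / ‖y‖ ^ 2 :=
    hs.eventually (lt_mem_nhds (by norm_num))
  obtain ⟨K, hK, hKs⟩ := Filter.mem_cocompact.1 h1
  obtain ⟨C, hC⟩ := ((hK.insert 0).bddAbove_image (f := fun y => -f y) hc.neg.continuousOn)
  have hC' : ∀ y ∈ insert (0 : Ed d) K, -f y ≤ C := fun y hy => hC ⟨y, hy, rfl⟩
  refine ⟨max C 0, fun y => ?_⟩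
  have hp := sq_nonneg ‖y‖
  by_cases hy : y ∈ insert (0 : Ed d) K
  · have := hC' y hy
    have := le_max_left C 0
    linarith
  · have hy0 : y ≠ 0 := fun h => hy (by simp [h])
    have hyK : y ∈ Kᶜ := fun h => hy (Set.mem_insert_of_mem _ h)
    have h2 : -(1/8 : ℝ) < f y / ‖y‖ ^ 2 := hKs hyK
    have hpos : 0 < ‖y‖ ^ 2 := by positivity
    rw [lt_div_iff₀ hpos] at h2
    have := le_max_right C 0
    linarith

theorem aux_gauss_integrable {d : ℕ} {b : ℝ} (hb : 0 < b) :
    Integrable (fun z : Ed d => Real.exp (-b * ‖z‖ ^ 2)) := by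
  have := (GaussianFourier.integrable_cexp_neg_mul_sq_norm_add (V := Ed d) (b := (b : ℂ))
    (by simpa using hb) 0 0).norm
  refine this.congr (Eventually.of_forall fun z => ?_)
  simp only [Complex.norm_exp]
  congr 1
  have : (-(b : ℂ) * (‖z‖ : ℂ) ^ 2 + 0 * ((inner ℝ (0 : Ed d) z : ℝ) : ℂ))
      = ((-b * ‖z‖ ^ 2 : ℝ) : ℂ) := by push_cast; ring
  rw [this, Complex.ofReal_re]

theorem aux_lim {d : ℕ} {ν : ℝ} (hν : 0 < ν) (f : Ed d → ℝ) (hc : Continuous f)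
    (hs : SubQuadratic f) (x : Ed d) :
    Tendsto (fun t : ℝ => ∫ z : Ed d, Real.exp (-(‖z‖ ^ 2 / 2 + f (x + √t • z)) / (2 * ν)))
      (nhdsWithin 0 (Ioi 0))
      (nhds (∫ z : Ed d, Real.exp (-(‖z‖ ^ 2 / 2 + f x) / (2 * ν)))) := by
  obtain ⟨C, hC⟩ := aux_bound f hc hs
  have hb : 0 < 1 / (8 * ν) := by positivity
  refine tendsto_integral_filter_of_dominated_convergence
    (fun z => Real.exp ((C + ‖x‖ ^ 2 / 4) / (2 * ν)) * Real.exp (-(1 / (8 * ν)) * ‖z‖ ^ 2))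
    (Eventually.of_forall fun t => ?_) ?_ ((aux_gauss_integrable hb).const_mul _)
    (Eventually.of_forall fun z => ?_)
  · exact Continuous.aestronglyMeasurable (by fun_prop)
  · have h1 : ∀ᶠ t : ℝ in nhdsWithin 0 (Ioi 0), t ∈ Ioo (0 : ℝ) 1 :=
      Ioo_mem_nhdsGT (by norm_num)
    filter_upwards [h1] with t ht
    refine Eventually.of_forall fun z => ?_
    rw [Real.norm_eq_abs, abs_of_pos (Real.exp_pos _), ← Real.exp_add]
    apply Real.exp_le_exp.2
    have h2 := hC (x + √t • z)
    have h3 : ‖x + √t • z‖ ≤ ‖x‖ + √t * ‖z‖ := by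
      refine (norm_add_le _ _).trans ?_
      rw [norm_smul, Real.norm_eq_abs, abs_of_nonneg (Real.sqrt_nonneg t)]
    have h4 : ‖x + √t • z‖ ^ 2 ≤ 2 * ‖x‖ ^ 2 + 2 * ‖z‖ ^ 2 := by
      have h5 : √t * ‖z‖ ≤ ‖z‖ := by
        have : √t ≤ 1 := Real.sqrt_le_one.2 ht.2.le
        exact mul_le_of_le_one_left (norm_nonneg _) this
      have h6 : ‖x + √t • z‖ ^ 2 ≤ (‖x‖ + ‖z‖) ^ 2 := by
        apply pow_le_pow_left₀ (norm_nonneg _); linarith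
      nlinarith [sq_nonneg (‖x‖ - ‖z‖)]
    have h7 : -(‖z‖ ^ 2 / 2 + f (x + √t • z)) / (2 * ν) ≤
        (C + ‖x‖ ^ 2 / 4 - ‖z‖ ^ 2 / 4) / (2 * ν) := by
      apply div_le_div_of_nonneg_right _ (by positivity)
      linarith
    refine h7.trans (le_of_eq ?_)
    field_simp
    ring
  · have hcont : Continuous (fun t : ℝ =>
        Real.exp (-(‖z‖ ^ 2 / 2 + f (x + √t • z)) / (2 * ν))) := by fun_prop
    have := (hcont.tendsto 0).mono_left (nhdsWithin_le_nhds (s := Ioi 0))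
    simpa using this

theorem aux_b0 {d : ℕ} {ν : ℝ} (hν : 0 < ν) (f : Ed d → ℝ) (x : Ed d) {t : ℝ} (ht : 0 < t) :
    b0 ν f x t = (4 * π * ν) ^ (-(d : ℝ) / 2) *
      ∫ z : Ed d, Real.exp (-(‖z‖ ^ 2 / 2 + f (x + √t • z)) / (2 * ν)) := by
  have hst : 0 < √t := Real.sqrt_pos.2 ht
  have h1 : ∫ y, Real.exp (-Phi f x y t / (2 * ν)) =
      ∫ w, Real.exp (-Phi f x (x + w) t / (2 * ν)) :=
    (integral_add_left_eq_self (fun y => Real.exp (-Phi f x y t / (2 * ν))) x).symm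
  have h2 := Measure.integral_comp_smul (volume : Measure (Ed d))
    (fun w => Real.exp (-Phi f x (x + w) t / (2 * ν))) √t
  have h3 : ∀ z : Ed d, Phi f x (x + √t • z) t = ‖z‖ ^ 2 / 2 + f (x + √t • z) := by
    intro z
    unfold Phi
    rw [sub_add_cancel_left, norm_neg, norm_smul, Real.norm_eq_abs, mul_pow, sq_abs,
      Real.sq_sqrt ht.le]
    congr 1
    field_simp
  simp only [h3] at h2
  rw [h2, b0, h1, Real.mul_rpow (by positivity) ht.le, smul_eq_mul, mul_assoc]
  congr 2
  rw [finrank_euclideanSpace_fin, abs_of_pos (by positivity), Real.sqrt_eq_rpow,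
    ← Real.rpow_natCast, ← Real.rpow_mul ht.le, ← Real.rpow_neg ht.le]
  congr 1
  ring

theorem aux_val {d : ℕ} {ν : ℝ} (hν : 0 < ν) (c : ℝ) :
    (4 * π * ν) ^ (-(d : ℝ) / 2) *
      ∫ z : Ed d, Real.exp (-(‖z‖ ^ 2 / 2 + c) / (2 * ν)) = Real.exp (-c / (2 * ν)) := by
  have h : ∀ z : Ed d, Real.exp (-(‖z‖ ^ 2 / 2 + c) / (2 * ν)) =
      Real.exp (-c / (2 * ν)) * Real.exp (-(1 / (4 * ν)) * ‖z‖ ^ 2) := by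
    intro z
    rw [← Real.exp_add]
    congr 1
    field_simp
    ring
  simp only [h]
  rw [integral_const_mul, GaussianFourier.integral_rexp_neg_mul_sq_norm (by positivity),
    finrank_euclideanSpace_fin]
  have h2 : π / (1 / (4 * ν)) = 4 * π * ν := by field_simp
  rw [h2, mul_left_comm, ← Real.rpow_add (by positivity)]
  have h3 : -(d : ℝ) / 2 + (d : ℝ) / 2 = 0 := by ring
  rw [h3]; simp

/-- The velocity potential attains its initial condition:
for every `x ∈ ℝ^d`, `−2ν ln b₀(x,t) → Θ₀(x)` as `t → 0⁺`. -/
theorem statement6 (d : ℕ) (hd : 1 ≤ d) (ν : ℝ) (hν : 0 < ν)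
    (Θ₀ : Ed d → ℝ) (hΘ₀cont : Continuous Θ₀) (hΘ₀dec : SubQuadratic Θ₀) :
    ∀ x : Ed d,
      Tendsto (fun t => -2 * ν * Real.log (b0 ν Θ₀ x t)) (nhdsWithin 0 (Ioi 0))
        (nhds (Θ₀ x)) := by
  intro x
  have h1 := (aux_lim hν Θ₀ hΘ₀cont hΘ₀dec x).const_mul ((4 * π * ν) ^ (-(d : ℝ) / 2))
  rw [aux_val hν] at h1
  have h2 : Tendsto (fun t => b0 ν Θ₀ x t) (nhdsWithin 0 (Ioi 0))
      (nhds (Real.exp (-Θ₀ x / (2 * ν)))) := by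
    refine h1.congr' ?_
    filter_upwards [self_mem_nhdsWithin] with t ht
    exact (aux_b0 hν Θ₀ x ht).symm
  have h3 := (h2.log (Real.exp_pos _).ne').const_mul (-2 * ν)
  rw [Real.log_exp] at h3
  have h4 : -2 * ν * (-Θ₀ x / (2 * ν)) = Θ₀ x := by field_simp
  rwa [h4] at h3
end
end

section
/- The passive tracer attains its initial condition: for every x ∈ ℝ^d, a₀(x,t)/b₀(x,t) → C₀(x) as t → 0⁺. -/
open MeasureTheory Real Filter Set

noncomputable section

theorem subq_bound {d : ℕ} (f : Ed d → ℝ) (hf : Continuous f) (hs : SubQuadratic f)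
    (ε : ℝ) (hε : 0 < ε) : ∃ K, 0 ≤ K ∧ ∀ y, |f y| ≤ ε * ‖y‖ ^ 2 + K := by
  have h1 : ∀ᶠ y in cocompact (Ed d), |f y / ‖y‖ ^ 2| < ε := by
    have := hs.eventually (Metric.ball_mem_nhds (0 : ℝ) hε)
    simpa [Real.dist_eq, abs_div] using this
  obtain ⟨S, hS, hSc⟩ := mem_cocompact.1 h1
  have hS2 : IsCompact (S ∪ {0}) := hS.union isCompact_singleton
  obtain ⟨K, hK⟩ := hS2.exists_bound_of_continuousOn hf.continuousOn
  refine ⟨K, (norm_nonneg _).trans (hK 0 (by simp)), fun y => ?_⟩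
  by_cases hy : y ∈ S ∪ {0}
  · have := hK y hy
    rw [Real.norm_eq_abs] at this
    nlinarith [sq_nonneg ‖y‖]
  · have hy1 : y ∉ S := fun h => hy (Or.inl h)
    have hy0 : y ≠ 0 := fun h => hy (Or.inr h)
    have h2 : |f y / ‖y‖ ^ 2| < ε := hSc hy1
    have h3 : 0 < ‖y‖ ^ 2 := by positivity
    rw [abs_div, abs_of_pos h3, div_lt_iff₀ h3] at h2
    have := (norm_nonneg _).trans (hK 0 (by simp))
    linarith

theorem key_lim {d : ℕ} (ν : ℝ) (hν : 0 < ν) (Θ f : Ed d → ℝ) (hΘ : Continuous Θ)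
    (hf : Continuous f) (K L : ℝ) (hK0 : 0 ≤ K)
    (hK : ∀ y, |f y| ≤ 1 * ‖y‖ ^ 2 + K) (hL : ∀ y, |Θ y| ≤ 1 / 16 * ‖y‖ ^ 2 + L) (x : Ed d) :
    Tendsto (fun s : ℝ => ∫ z : Ed d, f (x + s • z) *
        Real.exp (-(‖z‖ ^ 2 / (4 * ν)) - Θ (x + s • z) / (2 * ν)))
      (nhdsWithin 0 (Ioi 0))
      (nhds (∫ z : Ed d, f x * Real.exp (-(‖z‖ ^ 2 / (4 * ν)) - Θ x / (2 * ν)))) := by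
  have hInteg : Integrable (fun z : Ed d => Real.exp (-(1 / (8 * ν)) * ‖z‖ ^ 2)) := by
    have := (GaussianFourier.integrable_cexp_neg_mul_sq_norm_add (V := Ed d)
      (b := ((1 / (8 * ν) : ℝ) : ℂ)) (by rw [Complex.ofReal_re]; positivity) 0 0).norm
    refine this.congr (ae_of_all _ fun z => ?_)
    simp only [Complex.norm_exp]
    congr 1
    simp [← Complex.ofReal_pow, ← Complex.ofReal_mul, ← Complex.ofReal_neg]
  have hs1 : ∀ᶠ s : ℝ in nhdsWithin 0 (Ioi 0), 0 < s ∧ s < 1 :=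
    Ioo_mem_nhdsGT one_pos
  set A : ℝ := 2 * ‖x‖ ^ 2 + K + 32 * ν with hA
  set B : ℝ := (1 / 8 * ‖x‖ ^ 2 + L) / (2 * ν) with hB
  refine tendsto_integral_filter_of_dominated_convergence
    (fun z => A * Real.exp B * Real.exp (-(1 / (8 * ν)) * ‖z‖ ^ 2)) ?_ ?_ (hInteg.const_mul _) ?_
  · refine Eventually.of_forall fun s => Continuous.aestronglyMeasurable ?_
    fun_prop
  · filter_upwards [hs1] with s hs
    refine ae_of_all _ fun z => ?_
    have hn : ‖x + s • z‖ ^ 2 ≤ 2 * ‖x‖ ^ 2 + 2 * ‖z‖ ^ 2 := by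
      have h1 : ‖x + s • z‖ ≤ ‖x‖ + ‖z‖ := by
        refine (norm_add_le _ _).trans ?_
        rw [norm_smul, Real.norm_eq_abs, abs_of_pos hs.1]
        nlinarith [norm_nonneg z, hs.2]
      nlinarith [norm_nonneg (x + s • z), sq_nonneg (‖x‖ - ‖z‖)]
    have h2 := hK (x + s • z)
    have h3 := hL (x + s • z)
    rw [norm_mul, Real.norm_eq_abs, Real.norm_eq_abs, Real.abs_exp]
    set w : ℝ := ‖z‖ ^ 2 / (16 * ν) with hw
    have hw0 : 0 ≤ w := by positivity
    have hzw : ‖z‖ ^ 2 = 16 * ν * w := by rw [hw]; field_simp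
    have e1 : w + 1 ≤ Real.exp w := Real.add_one_le_exp w
    have f1 : |f (x + s • z)| ≤ A * Real.exp w := by
      have hp : 0 ≤ 2 * ‖x‖ ^ 2 + K := by positivity
      have : |f (x + s • z)| ≤ (2 * ‖x‖ ^ 2 + K) * 1 + 32 * ν * w := by
        nlinarith
      have a1 : (2 * ‖x‖ ^ 2 + K) * 1 ≤ (2 * ‖x‖ ^ 2 + K) * Real.exp w :=
        mul_le_mul_of_nonneg_left (by linarith) hp
      have a2 : 32 * ν * w ≤ 32 * ν * Real.exp w :=
        mul_le_mul_of_nonneg_left (by linarith) (by positivity)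
      rw [hA]; linarith
    have f2 : -(‖z‖ ^ 2 / (4 * ν)) - Θ (x + s • z) / (2 * ν) ≤ B + (-3 * w) := by
      have h4 : -Θ (x + s • z) ≤ (1 / 8 * ‖x‖ ^ 2 + L) + 2 * ν * w := by
        have := neg_abs_le (Θ (x + s • z))
        linarith
      have h5 : -Θ (x + s • z) / (2 * ν) ≤ ((1 / 8 * ‖x‖ ^ 2 + L) + 2 * ν * w) / (2 * ν) := by
        gcongr
      have h6 : ((1 / 8 * ‖x‖ ^ 2 + L) + 2 * ν * w) / (2 * ν) = B + w := by
        rw [hB]; field_simp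
      have h7 : ‖z‖ ^ 2 / (4 * ν) = 4 * w := by rw [hw]; field_simp; norm_num
      rw [h6, neg_div] at h5
      rw [h7]; linarith
    calc _ ≤ (A * Real.exp w) * Real.exp (B + (-3 * w)) :=
          mul_le_mul f1 (Real.exp_le_exp.2 f2) (Real.exp_pos _).le ((abs_nonneg _).trans f1)
      _ = A * Real.exp B * Real.exp (-(1 / (8 * ν)) * ‖z‖ ^ 2) := by
          have : -(1 / (8 * ν)) * ‖z‖ ^ 2 = w + (-3 * w) := by rw [hw]; field_simp; ring
          rw [this, Real.exp_add, Real.exp_add]; ring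
  · refine ae_of_all _ fun z => ?_
    have hc : Continuous fun s : ℝ => f (x + s • z) *
        Real.exp (-(‖z‖ ^ 2 / (4 * ν)) - Θ (x + s • z) / (2 * ν)) := by fun_prop
    have := (hc.tendsto 0).mono_left (nhdsWithin_le_nhds (s := Ioi 0))
    simpa using this

theorem key_subst {d : ℕ} (ν : ℝ) (hν : 0 < ν) (Θ f : Ed d → ℝ) (x : Ed d) (t : ℝ)
    (ht : 0 < t) :
    ∫ z : Ed d, f (x + √t • z) *
        Real.exp (-(‖z‖ ^ 2 / (4 * ν)) - Θ (x + √t • z) / (2 * ν)) =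
      ((√t) ^ d)⁻¹ * ∫ y, f y * Real.exp (-Phi Θ x y t / (2 * ν)) := by
  have hst : 0 < √t := Real.sqrt_pos.2 ht
  have h1 := Measure.integral_comp_smul (volume : Measure (Ed d))
    (fun y => f (x + y) * Real.exp (-Phi Θ x (x + y) t / (2 * ν))) (√t)
  rw [integral_add_left_eq_self (fun y => f y * Real.exp (-Phi Θ x y t / (2 * ν))) x] at h1
  rw [finrank_euclideanSpace_fin, abs_of_pos (by positivity), smul_eq_mul] at h1
  rw [← h1]
  congr 1
  funext z
  congr 2
  simp only [Phi, sub_add_cancel_left, norm_neg, norm_smul, Real.norm_eq_abs, mul_pow, sq_abs,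
    Real.sq_sqrt ht.le]
  field_simp
  ring

/-- The passive tracer attains its initial condition:
for every `x ∈ ℝ^d`, `a₀(x,t)/b₀(x,t) → C₀(x)` as `t → 0⁺`. -/
theorem statement11 (d : ℕ) (hd : 1 ≤ d) (ν : ℝ) (hν : 0 < ν)
    (Θ₀ : Ed d → ℝ) (hΘ₀cont : Continuous Θ₀) (hΘ₀dec : SubQuadratic Θ₀)
    (C₀ : Ed d → ℝ) (hC₀cont : Continuous C₀) (hC₀dec : SubQuadratic C₀) :
    ∀ x : Ed d,
      Tendsto (fun t => a0 ν Θ₀ C₀ x t / b0 ν Θ₀ x t) (nhdsWithin 0 (Ioi 0))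
        (nhds (C₀ x)) := by
  intro x
  obtain ⟨K, hK0, hK⟩ := subq_bound C₀ hC₀cont hC₀dec 1 one_pos
  obtain ⟨L, -, hL⟩ := subq_bound Θ₀ hΘ₀cont hΘ₀dec (1 / 16) (by norm_num)
  have hsq : Tendsto (fun t : ℝ => √t) (nhdsWithin 0 (Ioi 0)) (nhdsWithin 0 (Ioi 0)) := by
    refine tendsto_nhdsWithin_iff.2 ⟨?_, ?_⟩
    · have := (Real.continuous_sqrt.tendsto 0).mono_left (nhdsWithin_le_nhds (s := Ioi 0))
      simpa using this
    · filter_upwards [self_mem_nhdsWithin] with t ht using Real.sqrt_pos.2 ht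
  have hn := (key_lim ν hν Θ₀ C₀ hΘ₀cont hC₀cont K L hK0 hK hL x).comp hsq
  have hdn := (key_lim ν hν Θ₀ (fun _ => 1) hΘ₀cont continuous_const 1 L zero_le_one
    (fun y => by rw [abs_one]; nlinarith [sq_nonneg ‖y‖]) hL x).comp hsq
  set J : ℝ := ∫ z : Ed d, Real.exp (-(‖z‖ ^ 2 / (4 * ν)) - Θ₀ x / (2 * ν)) with hJ
  have hInteg : Integrable (fun z : Ed d => Real.exp (-(‖z‖ ^ 2 / (4 * ν)) - Θ₀ x / (2 * ν))) := by
    have := (GaussianFourier.integrable_cexp_neg_mul_sq_norm_add (V := Ed d)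
      (b := ((1 / (4 * ν) : ℝ) : ℂ)) (by rw [Complex.ofReal_re]; positivity) 0 0).norm
    refine (this.mul_const (Real.exp (- (Θ₀ x / (2 * ν))))).congr (ae_of_all _ fun z => ?_)
    simp only [Complex.norm_exp]
    rw [← Real.exp_add]
    congr 1
    have : (-((1 / (4 * ν) : ℝ) : ℂ) * (‖z‖ : ℂ) ^ 2 + 0 * ((inner ℝ 0 z : ℝ) : ℂ)) =
      ((-(1 / (4 * ν)) * ‖z‖ ^ 2 : ℝ) : ℂ) := by push_cast; ring
    rw [this, Complex.ofReal_re]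
    ring
  have hJ0 : 0 < J := integral_exp_pos hInteg
  simp only [one_mul] at hdn
  rw [integral_const_mul] at hn
  have hq := hn.div hdn hJ0.ne'
  rw [mul_div_assoc, div_self hJ0.ne', mul_one] at hq
  refine hq.congr' ?_
  filter_upwards [self_mem_nhdsWithin] with t ht
  have ht0 : (0 : ℝ) < t := ht
  have e1 := key_subst ν hν Θ₀ C₀ x t ht0
  have e2 := key_subst ν hν Θ₀ (fun _ => 1) x t ht0
  simp only [one_mul] at e2
  simp only [Pi.div_apply, Function.comp_apply]
  rw [e1, e2, a0, b0, mul_div_mul_left, mul_div_mul_left]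
  · exact (Real.rpow_pos_of_pos (by positivity) _).ne'
  · have := Real.sqrt_pos.2 ht0
    positivity
end
end
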